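/- The L_NFU-sentence (∀n∈ℕ)(beth(n) ≠ ∅ → beth(T(n)) = T(beth(n))) holds in every model of NFU^{-AC}. -/

import Mathlib

open FirstOrder Language

namespace NFUweak

/-! ## The language L_NFU -/

/-- Function symbols of `L_NFU`: a single binary (type-level) pairing function. -/
inductive NFUFunc : ℕ → Type
  | pair : NFUFunc 2

/-- Relation symbols of `L_NFU`: binary membership `∈` and unary sethood `S`. -/
inductive NFURel : ℕ → Type
  | mem : NFURel 2
  | isSet : NFURel 1

/-- The language `L_NFU`. -/
def LNFU : Language := ⟨NFUFunc, NFURel⟩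

/-- The membership relation symbol. -/
def memR : LNFU.Relations 2 := NFURel.mem

/-- The sethood relation symbol. -/
def setR : LNFU.Relations 1 := NFURel.isSet

/-- The pairing function symbol. -/
def pairF : LNFU.Functions 2 := NFUFunc.pair

/-! ## Stratification -/

/-- `termLevel σ t k` says that, relative to the assignment `σ` of levels (types)
to variables, the term `t` (and all of its subterms) receives level `k`. -/
def termLevel {α : Type} (σ : α → ℕ) : LNFU.Term α → ℕ → Prop
  | Term.var v, k => σ v = k
  | Term.func _ ts, k => ∀ i, termLevel σ (ts i) k

/-- The stratification condition on an atomic formula `R(ts)`: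
for `s ∈ t` the level of `t` is one more than that of `s`; `S(t)` imposes only
that `t` has a well-defined level. -/
def atomOK {α : Type} (σ : α → ℕ) : ∀ {l : ℕ}, LNFU.Relations l → (Fin l → LNFU.Term α) → Prop
  | _, NFURel.mem, ts => ∃ k, termLevel σ (ts 0) k ∧ termLevel σ (ts 1) (k + 1)
  | _, NFURel.isSet, ts => ∃ k, termLevel σ (ts 0) k

/-- `stratifiedFrom σ φ` : the formula `φ` is stratified, where the free
variables receive the levels given by `σ` (each quantified variable may receive
any level). -/
def stratifiedFrom : ∀ {n : ℕ}, ((Empty ⊕ Fin n) → ℕ) → LNFU.BoundedFormula Empty n → Prop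
  | _, _, BoundedFormula.falsum => True
  | _, σ, BoundedFormula.equal t s => ∃ k, termLevel σ t k ∧ termLevel σ s k
  | _, σ, BoundedFormula.rel R ts => atomOK σ R ts
  | _, σ, BoundedFormula.imp f g => stratifiedFrom σ f ∧ stratifiedFrom σ g
  | _, σ, BoundedFormula.all f =>
      ∃ k, stratifiedFrom
        (Sum.elim (fun e => σ (Sum.inl e)) (Fin.snoc (fun i => σ (Sum.inr i)) k)) f

/-- A formula of `L_NFU` is stratified if some assignment of levels to its
variables witnesses the stratification conditions. -/
def IsStratified {n : ℕ} (φ : LNFU.BoundedFormula Empty n) : Prop :=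
  ∃ σ, stratifiedFrom σ φ

/-! ## The axioms of NFU⁻ᴬᶜ -/

/-- Weak extensionality: sets with the same members are equal. -/
def weakExtAx : LNFU.Sentence :=
  ∀' ∀' ((setR.boundedFormula₁ &0 ⊓
          setR.boundedFormula₁ &1) ⟹
    (Term.bdEqual &0 &1 ⇔
      ∀' (memR.boundedFormula₂ &2 &0 ⇔
          memR.boundedFormula₂ &2 &1)))

/-- The pairing axiom: `⟨x,y⟩ = ⟨w,z⟩ → x = w ∧ y = z`. -/
def pairingAx : LNFU.Sentence :=
  ∀' ∀' ∀' ∀' (Term.bdEqual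
      (pairF.apply₂ &0 &1)
      (pairF.apply₂ &2 &3) ⟹
    (Term.bdEqual &0 &2 ⊓ Term.bdEqual &1 &3))

/-- The comprehension axiom for a formula `φ(x, z₀, …, z_{m-1})`, where the
variable `x` is (de Bruijn) variable `m` of `φ` and `z₀, …, z_{m-1}` are the
parameters: `∀ z⃗ ∃ y (S(y) ∧ ∀ x (x ∈ y ↔ φ(x, z⃗)))`. -/
def comprehensionAx (m : ℕ) (φ : LNFU.BoundedFormula Empty (m + 1)) : LNFU.Sentence :=
  BoundedFormula.alls (∃'
    (setR.boundedFormula₁ (Term.var (Sum.inr ⟨m, by omega⟩)) ⊓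
      ∀' (memR.boundedFormula₂
            (Term.var (Sum.inr ⟨m + 1, by omega⟩)) (Term.var (Sum.inr ⟨m, by omega⟩)) ⇔
          φ.liftAt 1 m)))

/-- The theory NFU⁻ᴬᶜ : weak extensionality, pairing and stratified comprehension. -/
def NFUmAC : LNFU.Theory :=
  {weakExtAx, pairingAx} ∪
    {s | ∃ (m : ℕ) (φ : LNFU.BoundedFormula Empty (m + 1)),
      IsStratified φ ∧ s = comprehensionAx m φ}

/-- The axiom `∀x S(x)` ("everything is a set"), turning NFU⁻ᴬᶜ into NF. -/
def allSetAx : LNFU.Sentence :=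
  ∀' (setR.boundedFormula₁ &0)

/-- The theory NF. -/
def NF : LNFU.Theory := NFUmAC ∪ {allSetAx}

end NFUweak
namespace NFUweak

/-! ## Semantic notions inside a model of NFU⁻ᴬᶜ -/

section Semantics

variable {M : Type} [LNFU.Structure M]

/-- The membership relation of the model. -/
def smem (x y : M) : Prop := Structure.RelMap memR ![x, y]

/-- The sethood predicate of the model. -/
def sset (x : M) : Prop := Structure.RelMap setR ![x]

/-- The (type-level) pairing function of the model. -/
def spair (x y : M) : M := Structure.funMap pairF ![x, y]

/-- `s` is the singleton `{x}`. -/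
def isSingletonOf (s x : M) : Prop := sset s ∧ ∀ z, smem z s ↔ z = x

/-- `e` is the empty set. -/
def isEmptySet (e : M) : Prop := sset e ∧ ∀ z, ¬ smem z e

/-- `v` is the universal set `V`. -/
def isUniverseOf (v : M) : Prop := sset v ∧ ∀ x, smem x v

/-- `f` is an internal function from (the members of) `X` to `Y`, coded as a set of
type-level ordered pairs `⟨a, b⟩`. -/
def isFunc (f X Y : M) : Prop :=
  sset f ∧ (∀ p, smem p f → ∃ a b, p = spair a b ∧ smem a X ∧ smem b Y) ∧
    (∀ a, smem a X → ∃ b, smem (spair a b) f) ∧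
    (∀ a b b', smem (spair a b) f → smem (spair a b') f → b = b')

/-- `f` is an internal injection from `X` into `Y`. -/
def isInjFunc (f X Y : M) : Prop :=
  isFunc f X Y ∧ ∀ a a' b, smem (spair a b) f → smem (spair a' b) f → a = a'

/-- `f` is an internal bijection between `X` and `Y`. -/
def isBijFunc (f X Y : M) : Prop :=
  isInjFunc f X Y ∧ ∀ b, smem b Y → ∃ a, smem (spair a b) f

/-- `X` and `Y` are equipollent (internally). -/
def equipollent (X Y : M) : Prop := ∃ f, isBijFunc f X Y

/-- `c` is the cardinal `|X|`, i.e. the equivalence class of `X` under equipollence. -/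
def isCardOf (c X : M) : Prop := sset c ∧ ∀ y, smem y c ↔ equipollent y X

/-- `c` is a cardinal. -/
def isCardinal (c : M) : Prop := ∃ X, sset X ∧ isCardOf c X

/-- `κ ≤ μ` for cardinals: some member of `κ` injects into some member of `μ`. -/
def cardLe (κ μ : M) : Prop := ∃ X Y f, smem X κ ∧ smem Y μ ∧ isInjFunc f X Y

/-- `Y = ι``X` is the set of singletons of members of `X`. -/
def isIotaImageOf (Y X : M) : Prop :=
  sset Y ∧ ∀ z, smem z Y ↔ ∃ x, smem x X ∧ isSingletonOf z x

/-- `t = T(c)` for a cardinal `c`:  `T(|X|) = |ι``X|`. -/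
def isTOf (t c : M) : Prop :=
  ∃ X Y, smem X c ∧ isIotaImageOf Y X ∧ isCardOf t Y

/-- `t = T⁴(c)`. -/
def isT4Of (t c : M) : Prop :=
  ∃ t₁ t₂ t₃, isTOf t₁ c ∧ isTOf t₂ t₁ ∧ isTOf t₃ t₂ ∧ isTOf t t₃

/-- `z` is the cardinal `0`, the set of all objects with no members. -/
def isZeroCard (z : M) : Prop := sset z ∧ ∀ y, smem y z ↔ ∀ w, ¬ smem w y

/-- `s = S(x)` is the cardinal successor:  `S(x) = {y : (∃z∈y)(y∖{z} ∈ x)}`. -/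
def isSuccOf (s x : M) : Prop :=
  sset s ∧ ∀ y, smem y s ↔
    ∃ z, smem z y ∧ ∃ d, sset d ∧ (∀ w, smem w d ↔ (smem w y ∧ w ≠ z)) ∧ smem d x

/-- `o` is the cardinal `1 = S(0)`. -/
def isOneCard (o : M) : Prop := ∃ z, isZeroCard z ∧ isSuccOf o z

/-- `I` is an inductive set: it contains `0` and is closed under `S`. -/
def isInductiveSet (I : M) : Prop :=
  sset I ∧ (∀ z, isZeroCard z → smem z I) ∧ ∀ a b, smem a I → isSuccOf b a → smem b I

/-- `n` is an internal natural number: it belongs to every inductive set. -/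
def isNat (n : M) : Prop := ∀ I, isInductiveSet I → smem n I

/-- `N` is the set `ℕ` of internal natural numbers. -/
def isNatSet (N : M) : Prop := sset N ∧ ∀ y, smem y N ↔ isNat y

/-- `m + k = n` on cardinals, via disjoint unions. -/
def cardAdd (m k n : M) : Prop :=
  ∃ x y u, smem x m ∧ smem y k ∧ (∀ w, ¬ (smem w x ∧ smem w y)) ∧
    sset u ∧ (∀ w, smem w u ↔ (smem w x ∨ smem w y)) ∧ smem u n

/-- `P` is the cartesian product `x × y` (with type-level pairs). -/
def isProdOf (P x y : M) : Prop :=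
  sset P ∧ ∀ p, smem p P ↔ ∃ a b, smem a x ∧ smem b y ∧ p = spair a b

/-- `k · m = n` on cardinals, via cartesian products. -/
def cardMul (k m n : M) : Prop :=
  ∃ x y P, smem x k ∧ smem y m ∧ isProdOf P x y ∧ smem P n

/-- `m ≤ n` on internal natural numbers: `∃k∈ℕ, m + k = n`. -/
def natLe (m n : M) : Prop := ∃ k, isNat k ∧ cardAdd m k n

/-- The model satisfies `AxCount₍≥₎ : (∀n∈ℕ)(T(n) ≤ n)`. -/
def axCountGeqHolds (M : Type) [LNFU.Structure M] : Prop :=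
  ∀ n : M, isNat n → ∀ t, isTOf t n → natLe t n

/-- The model satisfies `AxCount₍≤₎ : (∀n∈ℕ)(n ≤ T(n))`. -/
def axCountLeqHolds (M : Type) [LNFU.Structure M] : Prop :=
  ∀ n : M, isNat n → ∀ t, isTOf t n → natLe n t

/-- The model satisfies `AxCount : (∀n∈ℕ)(T(n) = n)`. -/
def axCountHolds (M : Type) [LNFU.Structure M] : Prop :=
  ∀ n : M, isNat n → ∀ t, isTOf t n → t = n

/-- The model satisfies the Axiom of Choice: every set of pairwise disjoint
nonempty sets has a transversal. -/
def acHolds (M : Type) [LNFU.Structure M] : Prop :=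
  ∀ X : M, sset X →
    (∀ y, smem y X → sset y ∧ ∃ z, smem z y) →
    (∀ y y', smem y X → smem y' X → y ≠ y' → ∀ z, ¬ (smem z y ∧ smem z y')) →
    ∃ t, sset t ∧ ∀ y, smem y X → ∃! z, smem z y ∧ smem z t

/-- `2^κ` is defined (i.e. `2^κ ≠ ∅`): there is a set `X` with `|ι``X| = κ`. -/
def twoPowDefined (κ : M) : Prop := ∃ X Y, isIotaImageOf Y X ∧ isCardOf κ Y

/-- `P` is the power set of `X`. -/
def isPowerSetOf (P X : M) : Prop :=
  sset P ∧ ∀ z, smem z P ↔ (sset z ∧ ∀ w, smem w z → smem w X)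

/-- `μ = 2^κ` (in the nonempty case): `μ = |P(X)|` for some `X` with `|ι``X| = κ`. -/
def isTwoPowOf (μ κ : M) : Prop :=
  ∃ X Y P, isIotaImageOf Y X ∧ isCardOf κ Y ∧ isPowerSetOf P X ∧ isCardOf μ P

/-- `f` is the internal function `beth : ℕ → NC ∪ {∅}` with `beth(0) = ℵ₀` and
`beth(n+1) = 2^{beth(n)}` (with value `∅` once undefined). -/
def isBethFun (f : M) : Prop :=
  sset f ∧
    (∀ p, smem p f → ∃ n y, isNat n ∧ p = spair n y) ∧
    (∀ n, isNat n → ∃ y, smem (spair n y) f) ∧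
    (∀ n y y', smem (spair n y) f → smem (spair n y') f → y = y') ∧
    (∀ z y, isZeroCard z → smem (spair z y) f → ∃ N, isNatSet N ∧ isCardOf y N) ∧
    (∀ n n' y y', isNat n → isSuccOf n' n →
      smem (spair n y) f → smem (spair n' y') f →
        ((isEmptySet y ∧ isEmptySet y') ∨
          (¬ isEmptySet y ∧
            (isTwoPowOf y' y ∨ (isEmptySet y' ∧ ¬ twoPowDefined y)))))

end Semantics

end NFUweak
namespace NFUweak

/-! ## BFEXTs and the structure ⟨BF, E⟩ inside a model of NFU⁻ᴬᶜ -/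

section BF

variable {M : Type} [LNFU.Structure M]

/-- `R` is an internal binary relation: a set of (type-level) ordered pairs. -/
def isRel (R : M) : Prop := sset R ∧ ∀ p, smem p R → ∃ x y, p = spair x y

/-- `x` belongs to the field `Dom(R) = dom(R) ∪ rng(R)` of the relation `R`. -/
def inField (x R : M) : Prop := ∃ y, smem (spair x y) R ∨ smem (spair y x) R

/-- `D` is the field `Dom(R)` of `R`, as a set. -/
def isFieldSetOf (D R : M) : Prop := sset D ∧ ∀ x, smem x D ↔ inField x R

/-- `R` is a BFEXT: a binary relation that is well-founded (every nonempty
subset of its field has an `R`-minimal element) and extensional. -/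
def isBFEXT (R : M) : Prop :=
  isRel R ∧
    (∀ B, sset B → (∃ b, smem b B) → (∀ b, smem b B → inField b R) →
      ∃ b, smem b B ∧ ∀ c, smem c B → ¬ smem (spair c b) R) ∧
    (∀ a b, inField a R → inField b R →
      (∀ c, smem (spair c a) R ↔ smem (spair c b) R) → a = b)

/-- `x` belongs to the smallest subset of `Dom(R)` containing `a` and closed
under `R`-predecessors. -/
def inSeg (x R a : M) : Prop :=
  ∀ B, sset B → (∀ b, smem b B → inField b R) → smem a B →
    (∀ b c, smem b B → smem (spair c b) R → smem c B) → smem x B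

/-- `s = seg_R(a)`: the restriction of `R` to the smallest subset of `Dom(R)`
containing `a` and closed under `R`-predecessors. -/
def isSegOf (s R a : M) : Prop :=
  sset s ∧ ∀ p, smem p s ↔
    (smem p R ∧ ∃ x y, p = spair x y ∧ inSeg x R a ∧ inSeg y R a)

/-- `R ∈ Ω`: `R` is a BFEXT with `R = seg_R(a)` for some `a ∈ Dom(R)`. -/
def inOmega (R : M) : Prop := isBFEXT R ∧ ∃ a, inField a R ∧ isSegOf R R a

/-- `a = 1_R` is the (unique) top of `R ∈ Ω`. -/
def isTopOf (a R : M) : Prop := inField a R ∧ isSegOf R R a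

/-- `f` is an internal isomorphism between the relations `R` and `S`. -/
def isIsoRel (f R S : M) : Prop :=
  sset f ∧
    (∀ p, smem p f → ∃ x y, p = spair x y ∧ inField x R ∧ inField y S) ∧
    (∀ x, inField x R → ∃ y, smem (spair x y) f) ∧
    (∀ x y y', smem (spair x y) f → smem (spair x y') f → y = y') ∧
    (∀ x x' y, smem (spair x y) f → smem (spair x' y) f → x = x') ∧
    (∀ y, inField y S → ∃ x, smem (spair x y) f) ∧
    (∀ x y x' y', smem (spair x x') f → smem (spair y y') f →
      (smem (spair x y) R ↔ smem (spair x' y') S))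

/-- `R` and `S` are isomorphic relations. -/
def relIso (R S : M) : Prop := ∃ f, isIsoRel f R S

/-- `t = [R]` is the set of all relations isomorphic to `R`. -/
def isTypeOf (t R : M) : Prop := sset t ∧ ∀ S, smem S t ↔ relIso S R

/-- `a ∈ BF`: `a = [R]` for some `R ∈ Ω`. -/
def inBF (a : M) : Prop := ∃ R, inOmega R ∧ isTypeOf a R

/-- `a E b` for `a, b ∈ BF`: for `R ∈ a`, `S ∈ b` there is `x ∈ Dom(S)` with
`⟨x, 1_S⟩ ∈ S` and `R ≅ seg_S(x)`. -/
def erel (a b : M) : Prop :=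
  ∃ R S, smem R a ∧ smem S b ∧
    ∃ x oneS, isTopOf oneS S ∧ smem (spair x oneS) S ∧
      ∃ sg, isSegOf sg S x ∧ relIso R sg

/-- `e` is the set `E ⊆ BF × BF`. -/
def isESet (e : M) : Prop :=
  sset e ∧ ∀ p, smem p e ↔ ∃ a b, p = spair a b ∧ inBF a ∧ inBF b ∧ erel a b

/-- `R' = T(R)`: the relation `{⟨{x},{y}⟩ : ⟨x,y⟩ ∈ R}`. -/
def isTRelOf (R' R : M) : Prop :=
  sset R' ∧ ∀ p, smem p R' ↔
    ∃ x y sx sy, smem (spair x y) R ∧ isSingletonOf sx x ∧ isSingletonOf sy y ∧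
      p = spair sx sy

/-- `t' = T(t)` for (isomorphism) types `t` of well-founded relations:
`T([R]) = [{⟨{x},{y}⟩ : ⟨x,y⟩ ∈ R}]`. -/
def isTTypeOf (t' t : M) : Prop :=
  ∃ R R', smem R t ∧ isTRelOf R' R ∧ isTypeOf t' R'

/-- `y = M₀ = E^ω`, the set of types of BFEXTs with finite domain. -/
def isM0Set (y : M) : Prop :=
  sset y ∧ ∀ a, smem a y ↔
    (inBF a ∧ ∃ R D c, smem R a ∧ isFieldSetOf D R ∧ isCardOf c D ∧ isNat c)

/-- `g` is the internal function `n ↦ M_n = E^{ω+n}` on the internal naturals: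
`M_0 = E^ω` and `M_{n+1} = {a ∈ BF : every E-predecessor of a lies in M_n}`. -/
def isMFun (g : M) : Prop :=
  sset g ∧
    (∀ p, smem p g → ∃ n y, isNat n ∧ p = spair n y) ∧
    (∀ n, isNat n → ∃ y, smem (spair n y) g) ∧
    (∀ n y y', smem (spair n y) g → smem (spair n y') g → y = y') ∧
    (∀ z y, isZeroCard z → smem (spair z y) g → isM0Set y) ∧
    (∀ n n' y y', isNat n → isSuccOf n' n →
      smem (spair n y) g → smem (spair n' y') g →
        (sset y' ∧ ∀ a, smem a y' ↔ (inBF a ∧ ∀ b, inBF b → erel b a → smem b y)))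

end BF

end NFUweak
namespace NFUweak

/-! ## The Simple Theory of Types with Infinity (TSTI) -/

/-- Formulae of the many-sorted language `L_TST`, with named variables:
`mem n i j` is `x^n_i ∈_n x^{n+1}_j`, `eq n i j` is `x^n_i = x^n_j`, and
`all n i φ` is `∀ x^n_i, φ`. -/
inductive TSTFormula : Type
  | mem (n i j : ℕ)
  | eq (n i j : ℕ)
  | fal
  | imp (φ ψ : TSTFormula)
  | all (n i : ℕ) (φ : TSTFormula)

/-- Update a many-sorted valuation at variable `x^n_i`. -/
def tstUpd {M : ℕ → Type} (v : ∀ n, ℕ → M n) (n i : ℕ) (a : M n) : ∀ m, ℕ → M m :=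
  fun m j => if h : m = n ∧ j = i then (congrArg M h.1).symm ▸ a else v m j

/-- Satisfaction of an `L_TST`-formula in the many-sorted structure `⟨M, E⟩`
under the valuation `v`. -/
def TSTFormula.Realize {M : ℕ → Type} (E : ∀ n, M n → M (n + 1) → Prop) :
    TSTFormula → (∀ n, ℕ → M n) → Prop
  | .mem n i j, v => E n (v n i) (v (n + 1) j)
  | .eq n i j, v => v n i = v n j
  | .fal, _ => False
  | .imp φ ψ, v => φ.Realize E v → ψ.Realize E v
  | .all n i φ, v => ∀ a : M n, φ.Realize E (tstUpd v n i a)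

/-- All sorts mentioned in the formula are `< k` (so it is an `L_k`-formula). -/
def TSTFormula.sortsLT : TSTFormula → ℕ → Prop
  | .mem n _ _, k => n + 1 < k
  | .eq n _ _, k => n < k
  | .fal, _ => True
  | .imp φ ψ, k => φ.sortsLT k ∧ ψ.sortsLT k
  | .all n _ φ, k => n < k ∧ φ.sortsLT k

/-- `p : M 2` is the Kuratowski ordered pair `⟨a, b⟩ = {{a},{a,b}}`. -/
def isKPair {M : ℕ → Type} (E : ∀ n, M n → M (n + 1) → Prop)
    (p : M 2) (a b : M 0) : Prop :=
  ∀ s : M 1, E 1 s p ↔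
    ((∀ z, E 0 z s ↔ z = a) ∨ (∀ z, E 0 z s ↔ (z = a ∨ z = b)))

/-- The axiom of Infinity: there are `x¹` and `f³` such that `f³` codes an
injective, non-surjective function from `x¹` to `x¹` (with Kuratowski pairs). -/
def TSTInfinity {M : ℕ → Type} (E : ∀ n, M n → M (n + 1) → Prop) : Prop :=
  ∃ (X : M 1) (f : M 3),
    (∀ p : M 2, E 2 p f → ∃ a b, E 0 a X ∧ E 0 b X ∧ isKPair E p a b) ∧
    (∀ a, E 0 a X → ∃ b p, E 0 b X ∧ E 2 p f ∧ isKPair E p a b) ∧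
    (∀ a b b' p p', E 2 p f → E 2 p' f → isKPair E p a b → isKPair E p' a b' → b = b') ∧
    (∀ a a' b p p', E 2 p f → E 2 p' f → isKPair E p a b → isKPair E p' a' b → a = a') ∧
    (∃ b, E 0 b X ∧ ∀ a p, E 2 p f → ¬ isKPair E p a b)

/-- `⟨M, E⟩` is a model of TSTI: all sorts are nonempty and Extensionality,
Comprehension (for every `L_TST`-formula) and Infinity hold. -/
def IsTSTIModel (M : ℕ → Type) (E : ∀ n, M n → M (n + 1) → Prop) : Prop :=
  (∀ n, Nonempty (M n)) ∧
    (∀ n, ∀ x y : M (n + 1), (∀ z, E n z x ↔ E n z y) → x = y) ∧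
    (∀ (φ : TSTFormula) (n i : ℕ) (v : ∀ m, ℕ → M m),
      ∃ y : M (n + 1), ∀ x : M n, E n x y ↔ φ.Realize E (tstUpd v n i x)) ∧
    TSTInfinity E

/-- `⟨M, E⟩` is a model of the fragment TSTI_k, which only refers to the sorts
`< k` (so `k ≥ 4` is needed for the axiom of Infinity to be expressible). -/
def IsTSTIModelBelow (k : ℕ) (M : ℕ → Type) (E : ∀ n, M n → M (n + 1) → Prop) : Prop :=
  (∀ n, n < k → Nonempty (M n)) ∧
    (∀ n, n + 1 < k → ∀ x y : M (n + 1), (∀ z, E n z x ↔ E n z y) → x = y) ∧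
    (∀ (φ : TSTFormula), φ.sortsLT k → ∀ (n i : ℕ), n + 1 < k →
      ∀ v : ∀ m, ℕ → M m,
        ∃ y : M (n + 1), ∀ x : M n, E n x y ↔ φ.Realize E (tstUpd v n i x)) ∧
    TSTInfinity E

/-! ## The language of arithmetic and the internal arithmetic of a model -/

/-- Function symbols of `L_PA`: `0`, `1`, `+` and `·`. -/
inductive PAFunc : ℕ → Type
  | zero : PAFunc 0
  | one : PAFunc 0
  | add : PAFunc 2
  | mul : PAFunc 2

/-- The language `L_PA` of arithmetic. -/
def LPA : Language := ⟨PAFunc, fun _ => Empty⟩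

/-- The type of internal natural numbers of a model of NFU⁻ᴬᶜ. -/
def NatSub (M : Type) [LNFU.Structure M] : Type := {n : M // isNat n}

/-- An `L_PA`-structure on the internal natural numbers of `M` is the internal
arithmetic if its operations are given by the internal graphs of `0`, `1`,
cardinal addition and cardinal multiplication. -/
def InternalArithOn (M : Type) [LNFU.Structure M] (A : LPA.Structure (NatSub M)) : Prop :=
  isZeroCard (A.funMap PAFunc.zero ![]).val ∧
    isOneCard (A.funMap PAFunc.one ![]).val ∧
    (∀ a b : NatSub M, cardAdd a.val b.val (A.funMap PAFunc.add ![a, b]).val) ∧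
    (∀ a b : NatSub M, cardMul a.val b.val (A.funMap PAFunc.mul ![a, b]).val)

/-- `φ^ℕ` holds in `M`: the sentence `φ` of `L_PA` is true in the internal
arithmetic `⟨ℕ, +, ·, 0, 1⟩` of `M`. -/
def internalPASat (M : Type) [LNFU.Structure M] (φ : LPA.Sentence) : Prop :=
  ∀ A : LPA.Structure (NatSub M), InternalArithOn M A →
    @Sentence.Realize LPA (NatSub M) A φ

end NFUweak

namespace NFUweak

/-! ## Intrinsically stratified formulas -/

/-- Variables of a context, with their level. -/
inductive Var : List ℕ → ℕ → Type
  | z {Γ : List ℕ} {k : ℕ} : Var (k :: Γ) k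
  | s {Γ : List ℕ} {k j : ℕ} : Var Γ k → Var (j :: Γ) k

/-- Terms of level `k`. Constants may be used at any level. -/
inductive Tm (M : Type) (Γ : List ℕ) (k : ℕ) : Type
  | var : Var Γ k → Tm M Γ k
  | con : M → Tm M Γ k
  | pair : Tm M Γ k → Tm M Γ k → Tm M Γ k

/-- Stratified formulas. -/
inductive Fm (M : Type) : List ℕ → Type
  | fal {Γ : List ℕ} : Fm M Γ
  | eq {Γ : List ℕ} {k : ℕ} : Tm M Γ k → Tm M Γ k → Fm M Γ
  | mem {Γ : List ℕ} {k : ℕ} : Tm M Γ k → Tm M Γ (k + 1) → Fm M Γ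
  | set {Γ : List ℕ} {k : ℕ} : Tm M Γ k → Fm M Γ
  | imp {Γ : List ℕ} : Fm M Γ → Fm M Γ → Fm M Γ
  | all {Γ : List ℕ} (k : ℕ) : Fm M (k :: Γ) → Fm M Γ

/-- Environments. -/
def Env (M : Type) : List ℕ → Type
  | [] => Unit
  | _ :: Γ => M × Env M Γ

def Env.nil {M : Type} : Env M [] := ()
def Env.cons {M : Type} {Γ : List ℕ} {k : ℕ} (x : M) (e : Env M Γ) : Env M (k :: Γ) := (x, e)
infixr:67 ";;" => Env.cons

def Var.real {M : Type} : ∀ {Γ : List ℕ} {k : ℕ}, Var Γ k → Env M Γ → M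
  | _, _, .z, e => e.1
  | _, _, .s v, e => v.real e.2

/-- weakening -/
def Tm.wk {M : Type} {Γ : List ℕ} {j k : ℕ} : Tm M Γ k → Tm M (j :: Γ) k
  | .var v => .var (.s v)
  | .con c => .con c
  | .pair a b => .pair a.wk b.wk

section
set_option linter.unusedSectionVars false
variable {M : Type} [LNFU.Structure M]

def Tm.real {Γ : List ℕ} {k : ℕ} (e : Env M Γ) : Tm M Γ k → M
  | .var v => v.real e
  | .con c => c
  | .pair a b => spair (a.real e) (b.real e)

def Fm.real : ∀ {Γ : List ℕ}, Fm M Γ → Env M Γ → Prop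
  | _, .fal, _ => False
  | _, .eq s t, e => s.real e = t.real e
  | _, .mem s t, e => smem (s.real e) (t.real e)
  | _, .set s, e => sset (s.real e)
  | _, .imp f g, e => f.real e → g.real e
  | _, .all _ f, e => ∀ x : M, f.real (x, e)

theorem Tm.real_wk {Γ : List ℕ} {j k : ℕ} (t : Tm M Γ k) (x : M) (e : Env M Γ) :
    (t.wk (j := j)).real (x ;; e) = t.real e := by
  induction t with
  | var v => rfl
  | con c => rfl
  | pair a b iha ihb => simp only [Tm.wk, Tm.real, iha, ihb]

/-! ### translation -/

def Tm.consts {Γ : List ℕ} {k : ℕ} : Tm M Γ k → List (M × ℕ)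
  | .var _ => []
  | .con c => [(c, k)]
  | .pair a b => a.consts ++ b.consts

def Fm.consts : ∀ {Γ : List ℕ}, Fm M Γ → List (M × ℕ)
  | _, .fal => []
  | _, .eq s t => s.consts ++ t.consts
  | _, .mem s t => s.consts ++ t.consts
  | _, .set s => s.consts
  | _, .imp f g => f.consts ++ g.consts
  | _, .all _ f => f.consts

def Var.idx (m : ℕ) : ∀ {Γ : List ℕ} {k : ℕ}, Var Γ k → Fin (m + Γ.length)
  | _ :: Γ, _, .z => Fin.last (m + Γ.length)
  | _ :: Γ, _, .s v => Fin.castSucc (n := m + Γ.length) (v.idx m)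

def envVal {m : ℕ} (p : Fin m → M) : ∀ (Γ : List ℕ), Env M Γ → (Fin (m + Γ.length) → M)
  | [], _ => p
  | _ :: Γ, e => Fin.snoc (n := m + Γ.length) (α := fun _ => M) (envVal p Γ e.2) e.1

def ctxLev {m : ℕ} (p : Fin m → ℕ) : ∀ (Γ : List ℕ), (Fin (m + Γ.length) → ℕ)
  | [] => p
  | k :: Γ => Fin.snoc (n := m + Γ.length) (α := fun _ => ℕ) (ctxLev p Γ) k

theorem envVal_idx {m : ℕ} (p : Fin m → M) : ∀ {Γ : List ℕ} {k : ℕ} (v : Var Γ k) (e : Env M Γ),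
    envVal p Γ e (v.idx m) = v.real e
  | _ :: Γ, _, .z, e => Fin.snoc_last (n := m + Γ.length) (α := fun _ => M) _ _
  | _ :: Γ, _, .s v, e =>
    (Fin.snoc_castSucc (n := m + Γ.length) (α := fun _ => M) _ _ _).trans (envVal_idx p v e.2)

theorem ctxLev_idx {m : ℕ} (p : Fin m → ℕ) : ∀ {Γ : List ℕ} {k : ℕ} (v : Var Γ k),
    ctxLev p Γ (v.idx m) = k
  | _ :: Γ, _, .z => Fin.snoc_last (n := m + Γ.length) (α := fun _ => ℕ) _ _
  | _ :: Γ, _, .s v =>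
    (Fin.snoc_castSucc (n := m + Γ.length) (α := fun _ => ℕ) _ _ _).trans (ctxLev_idx p v)

theorem envVal_castAdd {m : ℕ} (p : Fin m → M) (i : Fin m) : ∀ (Γ : List ℕ) (e : Env M Γ),
    envVal p Γ e (Fin.castAdd Γ.length i) = p i
  | [], _ => rfl
  | _ :: Γ, e =>
    (Fin.snoc_castSucc (n := m + Γ.length) (α := fun _ => M) _ _ (Fin.castAdd Γ.length i)).trans
      (envVal_castAdd p i Γ e.2)

theorem ctxLev_castAdd {m : ℕ} (p : Fin m → ℕ) (i : Fin m) : ∀ (Γ : List ℕ),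
    ctxLev p Γ (Fin.castAdd Γ.length i) = p i
  | [] => rfl
  | _ :: Γ =>
    (Fin.snoc_castSucc (n := m + Γ.length) (α := fun _ => ℕ) _ _ (Fin.castAdd Γ.length i)).trans
      (ctxLev_castAdd p i Γ)

def Tm.trans {m : ℕ} (g : M × ℕ → Fin m) {Γ : List ℕ} {k : ℕ} :
    Tm M Γ k → LNFU.Term (Empty ⊕ Fin (m + Γ.length))
  | .var v => Term.var (Sum.inr (v.idx m))
  | .con c => Term.var (Sum.inr (Fin.castAdd Γ.length (g (c, k))))
  | .pair a b => Term.func pairF ![a.trans g, b.trans g]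

def Fm.trans {m : ℕ} (g : M × ℕ → Fin m) :
    ∀ {Γ : List ℕ}, Fm M Γ → LNFU.BoundedFormula Empty (m + Γ.length)
  | _, .fal => BoundedFormula.falsum
  | _, .eq s t => BoundedFormula.equal (s.trans g) (t.trans g)
  | _, .mem s t => BoundedFormula.rel memR ![s.trans g, t.trans g]
  | _, .set s => BoundedFormula.rel setR ![s.trans g]
  | _, .imp f h => BoundedFormula.imp (f.trans g) (h.trans g)
  | Γ, .all _ f => BoundedFormula.all (n := m + Γ.length) (f.trans g)

theorem Tm.trans_real {m : ℕ} (g : M × ℕ → Fin m) (p : Fin m → M) {Γ : List ℕ} (e : Env M Γ)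
    {k : ℕ} (t : Tm M Γ k) (h : ∀ c ∈ t.consts, p (g c) = c.1) :
    (t.trans g).realize (Sum.elim Empty.elim (envVal p Γ e)) = t.real e := by
  induction t with
  | var v => simpa [Tm.trans, Tm.real] using envVal_idx p v e
  | con c =>
    have := h _ (List.mem_singleton.2 rfl)
    simpa [Tm.trans, Tm.real, envVal_castAdd] using this
  | pair a b iha ihb =>
    have ha := iha (fun c hc => h c (List.mem_append_left _ hc))
    have hb := ihb (fun c hc => h c (List.mem_append_right _ hc))
    simp only [Tm.trans, Tm.real, Term.realize, spair]
    congr 1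
    funext i
    refine Fin.cases ?_ (fun i => Fin.cases ?_ (fun i => i.elim0) i) i
    · exact ha
    · exact hb

theorem Tm.trans_level {m : ℕ} (g : M × ℕ → Fin m) (p : Fin m → ℕ) {Γ : List ℕ}
    {k : ℕ} (t : Tm M Γ k) (h : ∀ c ∈ t.consts, p (g c) = c.2) (σ : Empty ⊕ Fin (m + Γ.length) → ℕ)
    (hσ : ∀ i, σ (Sum.inr i) = ctxLev p Γ i) :
    termLevel σ (t.trans g) k := by
  induction t with
  | var v => exact (hσ _).trans (ctxLev_idx p v)
  | con c => exact (hσ _).trans ((ctxLev_castAdd p _ Γ).trans (h _ (List.mem_singleton.2 rfl)))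
  | pair a b iha ihb =>
    have ha := iha (fun c hc => h c (List.mem_append_left _ hc))
    have hb := ihb (fun c hc => h c (List.mem_append_right _ hc))
    intro i
    refine Fin.cases ?_ (fun i => Fin.cases ?_ (fun i => i.elim0) i) i
    · exact ha
    · exact hb

theorem Fm.trans_real {m : ℕ} (g : M × ℕ → Fin m) (p : Fin m → M) {Γ : List ℕ} (f : Fm M Γ) :
    ∀ (_ : ∀ c ∈ f.consts, p (g c) = c.1) (e : Env M Γ),
    (f.trans g).Realize Empty.elim (envVal p Γ e) ↔ f.real e := by
  induction f with
  | fal => intro h e; exact Iff.rfl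
  | eq s t =>
    intro h e
    have ha := s.trans_real g p e (fun c hc => h c (List.mem_append_left _ hc))
    have hb := t.trans_real g p e (fun c hc => h c (List.mem_append_right _ hc))
    simp only [Fm.trans, Fm.real, BoundedFormula.Realize, ha, hb]
  | mem s t =>
    intro h e
    have ha := s.trans_real g p e (fun c hc => h c (List.mem_append_left _ hc))
    have hb := t.trans_real g p e (fun c hc => h c (List.mem_append_right _ hc))
    simp only [Fm.trans, Fm.real, BoundedFormula.Realize, smem]
    rw [← ha, ← hb]
    apply iff_of_eq
    congr 1
    funext i
    refine Fin.cases ?_ (fun i => Fin.cases ?_ (fun i => i.elim0) i) i <;> rfl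
  | set s =>
    intro h e
    have ha := s.trans_real g p e h
    simp only [Fm.trans, Fm.real, BoundedFormula.Realize, sset]
    rw [← ha]
    apply iff_of_eq
    congr 1
    funext i
    refine Fin.cases ?_ (fun i => i.elim0) i; rfl
  | imp a b iha ihb =>
    intro h e
    exact imp_congr (iha (fun c hc => h c (List.mem_append_left _ hc)) e)
      (ihb (fun c hc => h c (List.mem_append_right _ hc)) e)
  | all k f ih =>
    intro h e
    exact forall_congr' fun x => ih h (x, e)

theorem Fm.trans_strat {m : ℕ} (g : M × ℕ → Fin m) (p : Fin m → ℕ) {Γ : List ℕ} (f : Fm M Γ) :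
    ∀ (_ : ∀ c ∈ f.consts, p (g c) = c.2) (σ : Empty ⊕ Fin (m + Γ.length) → ℕ)
    (_ : ∀ i, σ (Sum.inr i) = ctxLev p Γ i),
    stratifiedFrom σ (f.trans g) := by
  induction f with
  | fal => intro h e _; trivial
  | eq s t =>
    intro h σ hσ
    exact ⟨_, s.trans_level g p (fun c hc => h c (List.mem_append_left _ hc)) σ hσ,
      t.trans_level g p (fun c hc => h c (List.mem_append_right _ hc)) σ hσ⟩
  | mem s t =>
    intro h σ hσ
    exact ⟨_, s.trans_level g p (fun c hc => h c (List.mem_append_left _ hc)) σ hσ,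
      t.trans_level g p (fun c hc => h c (List.mem_append_right _ hc)) σ hσ⟩
  | set s =>
    intro h σ hσ
    exact ⟨_, s.trans_level g p h σ hσ⟩
  | imp a b iha ihb =>
    intro h σ hσ
    exact ⟨iha (fun c hc => h c (List.mem_append_left _ hc)) σ hσ,
      ihb (fun c hc => h c (List.mem_append_right _ hc)) σ hσ⟩
  | @all Γ k f ih =>
    intro h σ hσ
    refine ⟨k, ih h _ fun i => ?_⟩
    have : (fun i => σ (Sum.inr i)) = ctxLev p Γ := funext hσ
    show Fin.snoc (n := m + Γ.length) (α := fun _ => ℕ) (fun i => σ (Sum.inr i)) k i = _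
    rw [this]; rfl

/-! ### The axioms, semantically -/

class IsNFU (M : Type) [LNFU.Structure M] : Prop where
  out : M ⊨ NFUmAC

variable [IsNFU M]

theorem ext' {x y : M} (hx : sset x) (hy : sset y) (h : ∀ z, smem z x ↔ smem z y) : x = y := by
  have h0 : M ⊨ weakExtAx := (Theory.model_iff _).1 (IsNFU.out (M := M)) _ (Or.inl (Or.inl rfl))
  have h1 : ∀ x y : M, sset x ∧ sset y → (x = y ↔ ∀ z, smem z x ↔ smem z y) := by
    intro x y
    have := h0 x y
    simp only [BoundedFormula.realize_imp, BoundedFormula.realize_inf, BoundedFormula.realize_iff,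
      BoundedFormula.realize_all, BoundedFormula.realize_rel₁, BoundedFormula.realize_rel₂,
      BoundedFormula.realize_bdEqual] at this
    exact this
  exact (h1 x y ⟨hx, hy⟩).2 h

theorem pair_inj {x y w z : M} : spair x y = spair w z ↔ x = w ∧ y = z := by
  have h0 : M ⊨ pairingAx := (Theory.model_iff _).1 (IsNFU.out (M := M)) _ (Or.inl (Or.inr rfl))
  have h1 : ∀ x y w z : M, spair x y = spair w z → x = w ∧ y = z := by
    intro x y w z
    have := h0 x y w z
    simp only [BoundedFormula.realize_imp, BoundedFormula.realize_inf, 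
      BoundedFormula.realize_bdEqual, Term.realize_functions_apply₂] at this
    exact this
  exact ⟨h1 x y w z, fun h => by rw [h.1, h.2]⟩

theorem comp0 (m : ℕ) (φ : LNFU.BoundedFormula Empty (m + 1)) (hφ : IsStratified φ)
    (p : Fin m → M) : ∃ y : M, sset y ∧ ∀ x, smem x y ↔
      φ.Realize Empty.elim (Fin.snoc (α := fun _ => M) p x : Fin (m+1) → M) := by
  have h0 : M ⊨ comprehensionAx m φ :=
    (Theory.model_iff _).1 (IsNFU.out (M := M)) _ (Or.inr ⟨m, φ, hφ, rfl⟩)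
  have h1 := (BoundedFormula.realize_alls (v := default)).1 h0 p
  rw [BoundedFormula.realize_ex] at h1
  obtain ⟨y, hy⟩ := h1
  rw [BoundedFormula.realize_inf, BoundedFormula.realize_all] at hy
  obtain ⟨hy1, hy2⟩ := hy
  refine ⟨y, ?_, fun x => ?_⟩
  · rw [BoundedFormula.realize_rel₁] at hy1
    have e : (Fin.snoc (α := fun _ => M) p y : Fin (m+1) → M) ⟨m, by omega⟩ = y :=
      Fin.snoc_last (α := fun _ => M) y p
    simp only [Term.realize_var, Sum.elim_inr, e] at hy1
    exact hy1
  · have h2 := hy2 x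
    rw [BoundedFormula.realize_iff, BoundedFormula.realize_rel₂,
      BoundedFormula.realize_liftAt_one (by omega)] at h2
    simp only [Term.realize_var, Sum.elim_inr] at h2
    have e1 : (Fin.snoc (α := fun _ => M) (Fin.snoc (α := fun _ => M) p y : Fin (m+1) → M) x
        : Fin (m+1+1) → M) ⟨m + 1, by omega⟩ = x :=
      Fin.snoc_last (α := fun _ => M) x _
    have e2 : (Fin.snoc (α := fun _ => M) (Fin.snoc (α := fun _ => M) p y : Fin (m+1) → M) x
        : Fin (m+1+1) → M) ⟨m, by omega⟩ = y :=
      (Fin.snoc_castSucc (α := fun _ => M) x _ (Fin.last m)).trans (Fin.snoc_last (α := fun _ => M) y p)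
    rw [e1, e2] at h2
    refine h2.trans (iff_of_eq ?_)
    have hd : (default : Empty → M) = Empty.elim := Subsingleton.elim _ _
    rw [hd]
    congr 1
    funext i
    refine Fin.lastCases ?_ (fun i => ?_) i
    · simp only [Function.comp, Fin.val_last, lt_irrefl, if_false, Fin.snoc_last]
      exact Fin.snoc_last (α := fun _ => M) x _
    · simp only [Function.comp, Fin.val_castSucc, i.2, if_true, Fin.snoc_castSucc]

theorem comp (k : ℕ) (φ : Fm M [k]) : ∃ y : M, sset y ∧ ∀ x, smem x y ↔ φ.real (x ;; Env.nil) := by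
  classical
  let L : List (M × ℕ) := (Classical.choice (show Nonempty M from ?_), 0) :: φ.consts
  have hL : ∀ c : M × ℕ, ∃ i : Fin L.length, c ∈ φ.consts → L.get i = c := by
    intro c
    by_cases hc : c ∈ φ.consts
    · obtain ⟨i, hi⟩ := List.get_of_mem (List.mem_cons_of_mem _ hc : c ∈ L)
      exact ⟨i, fun _ => hi⟩
    · exact ⟨⟨0, by simp [L]⟩, fun h => (hc h).elim⟩
  choose g hg using hL
  obtain ⟨y, hy1, hy2⟩ := comp0 L.length (φ.trans g)
    ⟨_, φ.trans_strat g (fun i => (L.get i).2) (fun c hc => by rw [hg c hc])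
      (Sum.elim Empty.elim (ctxLev (fun i => (L.get i).2) [k])) (fun i => rfl)⟩ (fun i => (L.get i).1)
  refine ⟨y, hy1, fun x => (hy2 x).trans ?_⟩
  exact φ.trans_real g (fun i => (L.get i).1) (fun c hc => by rw [hg c hc]) (x, ())
  · obtain ⟨y, -⟩ := comp0 (M := M) 0 BoundedFormula.falsum ⟨fun _ => 0, trivial⟩ Fin.elim0
    exact ⟨y⟩
end
end NFUweak

namespace NFUweak
section
set_option linter.unusedSectionVars false
variable {M : Type} [LNFU.Structure M]

/-! ### Derived connectives and their semantics -/

section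
variable {Γ : List ℕ} {k j i l m q : ℕ}

def v0 : Tm M (k :: Γ) k := .var .z
def v1 : Tm M (j :: k :: Γ) k := .var (.s .z)
def v2 : Tm M (i :: j :: k :: Γ) k := .var (.s (.s .z))
def v3 : Tm M (l :: i :: j :: k :: Γ) k := .var (.s (.s (.s .z)))
def v4 : Tm M (m :: l :: i :: j :: k :: Γ) k := .var (.s (.s (.s (.s .z))))
def v5 : Tm M (q :: m :: l :: i :: j :: k :: Γ) k := .var (.s (.s (.s (.s (.s .z)))))

def fnot (a : Fm M Γ) : Fm M Γ := .imp a .fal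
def fand (a b : Fm M Γ) : Fm M Γ := fnot (.imp a (fnot b))
def for' (a b : Fm M Γ) : Fm M Γ := .imp (fnot a) b
def fiff (a b : Fm M Γ) : Fm M Γ := fand (.imp a b) (.imp b a)
def fex (k : ℕ) (a : Fm M (k :: Γ)) : Fm M Γ := fnot (.all k (fnot a))

@[simp] theorem real_v0 (x : M) (e : Env M Γ) :
    (v0 : Tm M (k :: Γ) k).real (x ;; e) = x := rfl
@[simp] theorem real_v1 (x y : M) (e : Env M Γ) :
    (v1 : Tm M (j :: k :: Γ) k).real (y ;; x ;; e) = x := rfl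
@[simp] theorem real_v2 (x y z : M) (e : Env M Γ) :
    (v2 : Tm M (i :: j :: k :: Γ) k).real (z ;; y ;; x ;; e) = x := rfl
@[simp] theorem real_v3 (x y z w : M) (e : Env M Γ) :
    (v3 : Tm M (l :: i :: j :: k :: Γ) k).real (w ;; z ;; y ;; x ;; e) = x := rfl
@[simp] theorem real_v4 (x y z w u : M) (e : Env M Γ) :
    (v4 : Tm M (m :: l :: i :: j :: k :: Γ) k).real
      (u ;; w ;; z ;; y ;; x ;; e) = x := rfl
@[simp] theorem real_v5 (x y z w u r : M) (e : Env M Γ) :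
    (v5 : Tm M (q :: m :: l :: i :: j :: k :: Γ) k).real
      (r ;; u ;; w ;; z ;; y ;; x ;; e) = x := rfl
@[simp] theorem real_con (c : M) (e : Env M Γ) : (Tm.con c : Tm M Γ k).real e = c := rfl
@[simp] theorem real_pair (a b : Tm M Γ k) (e : Env M Γ) :
    (Tm.pair a b).real e = spair (a.real e) (b.real e) := rfl
attribute [simp] Tm.real_wk

variable (e : Env M Γ)
@[simp] theorem real_eq (a b : Tm M Γ k) : (Fm.eq a b).real e ↔ a.real e = b.real e := Iff.rfl
@[simp] theorem real_mem (a : Tm M Γ k) (b : Tm M Γ (k+1)) :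
    (Fm.mem a b).real e ↔ smem (a.real e) (b.real e) := Iff.rfl
@[simp] theorem real_set (a : Tm M Γ k) : (Fm.set a).real e ↔ sset (a.real e) := Iff.rfl
@[simp] theorem real_imp (a b : Fm M Γ) : (Fm.imp a b).real e ↔ (a.real e → b.real e) := Iff.rfl
@[simp] theorem real_all (a : Fm M (k :: Γ)) :
    (Fm.all k a).real e ↔ ∀ x : M, a.real (x ;; e) := Iff.rfl
@[simp] theorem real_fnot (a : Fm M Γ) : (fnot a).real e ↔ ¬ a.real e := Iff.rfl
@[simp] theorem real_fand (a b : Fm M Γ) : (fand a b).real e ↔ (a.real e ∧ b.real e) := by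
  simp [fand]
@[simp] theorem real_for (a b : Fm M Γ) : (for' a b).real e ↔ (a.real e ∨ b.real e) := by
  simp [for', or_iff_not_imp_left]
@[simp] theorem real_fiff (a b : Fm M Γ) : (fiff a b).real e ↔ (a.real e ↔ b.real e) := by
  simp [fiff, iff_def]
@[simp] theorem real_fex (a : Fm M (k :: Γ)) :
    (fex k a).real e ↔ ∃ x : M, a.real (x ;; e) := by
  simp [fex]

/-! ### Formulas for the basic notions -/

def fSing (s : Tm M Γ (k+1)) (x : Tm M Γ k) : Fm M Γ :=
  fand (.set s) (.all k (fiff (.mem v0 s.wk) (.eq v0 x.wk)))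
@[simp] theorem real_fSing (s : Tm M Γ (k+1)) (x : Tm M Γ k) :
    (fSing s x).real e ↔ isSingletonOf (s.real e) (x.real e) := by
  simp [fSing, isSingletonOf]

def fEmpty (s : Tm M Γ (k+1)) : Fm M Γ := fand (.set s) (.all k (fnot (.mem v0 s.wk)))
@[simp] theorem real_fEmpty (s : Tm M Γ (k+1)) : (fEmpty s).real e ↔ isEmptySet (s.real e) := by
  simp [fEmpty, isEmptySet]

def fFunc (f X Y : Tm M Γ (k+1)) : Fm M Γ :=
  fand (.set f) (fand
    (.all k (.imp (.mem v0 f.wk) (fex k (fex k (fand (.eq v2 (.pair v1 v0))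
      (fand (.mem v1 X.wk.wk.wk) (.mem v0 Y.wk.wk.wk)))))))
    (fand (.all k (.imp (.mem v0 X.wk) (fex k (.mem (.pair v1 v0) f.wk.wk))))
      (.all k (.all k (.all k (.imp (.mem (.pair v2 v1) f.wk.wk.wk)
        (.imp (.mem (.pair v2 v0) f.wk.wk.wk) (.eq v1 v0))))))))
@[simp] theorem real_fFunc (f X Y : Tm M Γ (k+1)) :
    (fFunc f X Y).real e ↔ isFunc (f.real e) (X.real e) (Y.real e) := by
  simp [fFunc, isFunc]

def fBij (f X Y : Tm M Γ (k+1)) : Fm M Γ :=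
  fand (fand (fFunc f X Y) (.all k (.all k (.all k (.imp (.mem (.pair v2 v0) f.wk.wk.wk)
        (.imp (.mem (.pair v1 v0) f.wk.wk.wk) (.eq v2 v1)))))))
    (.all k (.imp (.mem v0 Y.wk) (fex k (.mem (.pair v0 v1) f.wk.wk))))
@[simp] theorem real_fBij (f X Y : Tm M Γ (k+1)) :
    (fBij f X Y).real e ↔ isBijFunc (f.real e) (X.real e) (Y.real e) := by
  simp [fBij, isBijFunc, isInjFunc]

def fEquip (X Y : Tm M Γ (k+1)) : Fm M Γ := fex (k+1) (fBij v0 X.wk Y.wk)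
@[simp] theorem real_fEquip (X Y : Tm M Γ (k+1)) :
    (fEquip X Y).real e ↔ equipollent (X.real e) (Y.real e) := by
  simp [fEquip, equipollent]

def fCard (c : Tm M Γ (k+2)) (X : Tm M Γ (k+1)) : Fm M Γ :=
  fand (.set c) (.all (k+1) (fiff (.mem v0 c.wk) (fEquip v0 X.wk)))
@[simp] theorem real_fCard (c : Tm M Γ (k+2)) (X : Tm M Γ (k+1)) :
    (fCard c X).real e ↔ isCardOf (c.real e) (X.real e) := by
  simp [fCard, isCardOf]

def fIota (Y : Tm M Γ (k+2)) (X : Tm M Γ (k+1)) : Fm M Γ :=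
  fand (.set Y) (.all (k+1) (fiff (.mem v0 Y.wk) (fex k (fand (.mem v0 X.wk.wk) (fSing v1 v0)))))
@[simp] theorem real_fIota (Y : Tm M Γ (k+2)) (X : Tm M Γ (k+1)) :
    (fIota Y X).real e ↔ isIotaImageOf (Y.real e) (X.real e) := by
  simp [fIota, isIotaImageOf]

def fT (t : Tm M Γ (k+3)) (c : Tm M Γ (k+2)) : Fm M Γ :=
  fex (k+1) (fex (k+2) (fand (.mem v1 c.wk.wk) (fand (fIota v0 v1) (fCard t.wk.wk v0))))
@[simp] theorem real_fT (t : Tm M Γ (k+3)) (c : Tm M Γ (k+2)) :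
    (fT t c).real e ↔ isTOf (t.real e) (c.real e) := by
  simp [fT, isTOf]

def fZero (z : Tm M Γ (k+2)) : Fm M Γ :=
  fand (.set z) (.all (k+1) (fiff (.mem v0 z.wk) (.all k (fnot (.mem v0 v1)))))
@[simp] theorem real_fZero (z : Tm M Γ (k+2)) : (fZero z).real e ↔ isZeroCard (z.real e) := by
  simp [fZero, isZeroCard]

def fSucc (s x : Tm M Γ (k+2)) : Fm M Γ :=
  fand (.set s) (.all (k+1) (fiff (.mem v0 s.wk) (fex k (fand (.mem v0 v1)
    (fex (k+1) (fand (.set v0) (fand (.all k (fiff (.mem v0 v1) (fand (.mem v0 v3)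
      (fnot (.eq v0 v2))))) (.mem v0 x.wk.wk.wk))))))))
@[simp] theorem real_fSucc (s x : Tm M Γ (k+2)) :
    (fSucc s x).real e ↔ isSuccOf (s.real e) (x.real e) := by
  simp [fSucc, isSuccOf]

def fNat (n : Tm M Γ (k+2)) : Fm M Γ :=
  .all (k+3) (.imp (fand (.set v0) (fand (.all (k+2) (.imp (fZero v0) (.mem v0 v1)))
    (.all (k+2) (.all (k+2) (.imp (.mem v1 v2) (.imp (fSucc v0 v1) (.mem v0 v2)))))))
    (.mem n.wk v0))
@[simp] theorem real_fNat (n : Tm M Γ (k+2)) : (fNat n).real e ↔ isNat (n.real e) := by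
  simp [fNat, isNat, isInductiveSet]
end

/-! ### Basic set theory -/

variable [IsNFU M]

theorem ex_sing (x : M) : ∃ s, isSingletonOf s x := by
  obtain ⟨y, h1, h2⟩ := comp 0 (.eq v0 (.con x) : Fm M [0])
  exact ⟨y, h1, by simpa using h2⟩
noncomputable def sing (x : M) : M := (ex_sing x).choose
theorem isSing_iff {s x : M} : isSingletonOf s x ↔ s = sing x := by
  have h := (ex_sing x).choose_spec
  refine ⟨fun h1 => ext' h1.1 h.1 fun z => (h1.2 z).trans (h.2 z).symm, ?_⟩
  rintro rfl; exact h
@[simp] theorem mem_sing {z x : M} : smem z (sing x) ↔ z = x := (isSing_iff.2 rfl).2 z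
theorem set_sing (x : M) : sset (sing x) := (isSing_iff.2 rfl).1
@[simp] theorem sing_inj {x y : M} : sing x = sing y ↔ x = y :=
  ⟨fun h => by rw [← mem_sing, ← h, mem_sing], fun h => h ▸ rfl⟩

theorem ex_iota (X : M) : ∃ Y, isIotaImageOf Y X := by
  obtain ⟨y, h1, h2⟩ := comp 1 (fex 0 (fand (.mem v0 (.con X)) (fSing v1 v0)) : Fm M [1])
  exact ⟨y, h1, by simpa using h2⟩
noncomputable def iota (x : M) : M := (ex_iota x).choose
theorem isIota_iff {s x : M} : isIotaImageOf s x ↔ s = iota x := by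
  have h := (ex_iota x).choose_spec
  refine ⟨fun h1 => ext' h1.1 h.1 fun z => (h1.2 z).trans (h.2 z).symm, ?_⟩
  rintro rfl; exact h
@[simp] theorem mem_iota {z X : M} : smem z (iota X) ↔ ∃ x, smem x X ∧ z = sing x := by
  have := (isIota_iff.2 (rfl : iota X = _)).2 z
  simpa [isSing_iff] using this
theorem set_iota (X : M) : sset (iota X) := (isIota_iff.2 rfl).1

theorem ex_card (X : M) : ∃ Y, isCardOf Y X := by
  obtain ⟨y, h1, h2⟩ := comp 1 (fEquip v0 (.con X) : Fm M [1])
  exact ⟨y, h1, by simpa using h2⟩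
noncomputable def card (x : M) : M := (ex_card x).choose
theorem isCard_iff {s x : M} : isCardOf s x ↔ s = card x := by
  have h := (ex_card x).choose_spec
  refine ⟨fun h1 => ext' h1.1 h.1 fun z => (h1.2 z).trans (h.2 z).symm, ?_⟩
  rintro rfl; exact h
@[simp] theorem mem_card {z X : M} : smem z (card X) ↔ equipollent z X :=
  (isCard_iff.2 (rfl : card X = _)).2 z
theorem set_card (X : M) : sset (card X) := (isCard_iff.2 rfl).1

theorem ex_pow (X : M) : ∃ P, isPowerSetOf P X := by
  obtain ⟨y, h1, h2⟩ := comp 1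
    (fand (.set v0) (.all 0 (.imp (.mem v0 v1) (.mem v0 (.con X)))) : Fm M [1])
  exact ⟨y, h1, by simpa using h2⟩
noncomputable def pow (x : M) : M := (ex_pow x).choose
theorem isPow_iff {s x : M} : isPowerSetOf s x ↔ s = pow x := by
  have h := (ex_pow x).choose_spec
  refine ⟨fun h1 => ext' h1.1 h.1 fun z => (h1.2 z).trans (h.2 z).symm, ?_⟩
  rintro rfl; exact h
@[simp] theorem mem_pow {z X : M} : smem z (pow X) ↔ (sset z ∧ ∀ w, smem w z → smem w X) :=
  (isPow_iff.2 (rfl : pow X = _)).2 z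

theorem ex_del (X z : M) : ∃ d, sset d ∧ ∀ w, smem w d ↔ (smem w X ∧ w ≠ z) := by
  obtain ⟨y, h1, h2⟩ := comp 0
    (fand (.mem v0 (.con X)) (fnot (.eq v0 (.con z))) : Fm M [0])
  exact ⟨y, h1, by simpa using h2⟩

theorem ex_ins (X z : M) : ∃ d, sset d ∧ ∀ w, smem w d ↔ (smem w X ∨ w = z) := by
  obtain ⟨y, h1, h2⟩ := comp 0
    (for' (.mem v0 (.con X)) (.eq v0 (.con z)) : Fm M [0])
  exact ⟨y, h1, by simpa using h2⟩

theorem ex_empty : ∃ d : M, isEmptySet d := by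
  obtain ⟨y, h1, h2⟩ := comp 0 (Fm.fal : Fm M [0])
  exact ⟨y, h1, fun z hz => (h2 z).1 hz⟩

theorem ex_univ : ∃ d : M, ∀ x, smem x d := by
  obtain ⟨y, h1, h2⟩ := comp 0 (.eq v0 v0 : Fm M [0])
  exact ⟨y, fun x => (h2 x).2 rfl⟩

/-! ### Equipollence -/

/-- An external relation that is a bijection between the members of `X` and `Y`. -/
structure Bij (R : M → M → Prop) (X Y : M) : Prop where
  tot : ∀ a, smem a X → ∃ b, smem b Y ∧ R a b
  sur : ∀ b, smem b Y → ∃ a, smem a X ∧ R a b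
  fn : ∀ a b b', smem a X → smem b Y → smem b' Y → R a b → R a b' → b = b'
  inj : ∀ a a' b, smem a X → smem a' X → smem b Y → R a b → R a' b → a = a'

theorem equip_of {k : ℕ} (R : M → M → Prop) (φ : Fm M [k, k, k])
    (hφ : ∀ p a b, φ.real (b ;; a ;; p ;; Env.nil) ↔ R a b) {X Y : M}
    (h : Bij R X Y) : equipollent X Y := by
  obtain ⟨g, hg, hg2⟩ : ∃ g : M, sset g ∧ ∀ p, smem p g ↔
      ∃ a b, p = spair a b ∧ smem a X ∧ smem b Y ∧ R a b := by
    obtain ⟨g, hg, hg2⟩ := comp k (fex k (fex k (fand (.eq v2 (.pair v1 v0))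
      (fand (.mem v1 (.con X)) (fand (.mem v0 (.con Y)) φ)))) : Fm M [k])
    exact ⟨g, hg, by simpa [hφ] using hg2⟩
  have hp : ∀ a b, smem (spair a b) g ↔ (smem a X ∧ smem b Y ∧ R a b) := by
    intro a b
    rw [hg2]
    constructor
    · rintro ⟨a', b', h1, h2⟩
      obtain ⟨rfl, rfl⟩ := pair_inj.1 h1
      exact h2
    · intro h; exact ⟨a, b, rfl, h⟩
  refine ⟨g, ⟨⟨hg, ?_, ?_, ?_⟩, ?_⟩, ?_⟩
  · intro p hp'
    obtain ⟨a, b, h1, h2, h3, -⟩ := (hg2 p).1 hp'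
    exact ⟨a, b, h1, h2, h3⟩
  · intro a ha
    obtain ⟨b, hb, hr⟩ := h.tot a ha
    exact ⟨b, (hp _ _).2 ⟨ha, hb, hr⟩⟩
  · intro a b b' h1 h2
    rw [hp] at h1 h2
    exact h.fn a b b' h1.1 h1.2.1 h2.2.1 h1.2.2 h2.2.2
  · intro a b b' h1 h2
    rw [hp] at h1 h2
    exact h.inj _ _ _ h1.1 h2.1 h1.2.1 h1.2.2 h2.2.2
  · intro b hb
    obtain ⟨a, ha, hr⟩ := h.sur b hb
    exact ⟨a, (hp _ _).2 ⟨ha, hb, hr⟩⟩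

theorem equip_bij {X Y : M} (h : equipollent X Y) :
    ∃ g : M, Bij (fun a b => smem (spair a b) g) X Y ∧
      ∀ a b, smem (spair a b) g → smem a X ∧ smem b Y := by
  obtain ⟨g, ⟨⟨h1, h2, h3, h4⟩, h5⟩, h6⟩ := h
  have hm : ∀ a b, smem (spair a b) g → smem a X ∧ smem b Y := by
    intro a b hab
    obtain ⟨a', b', e, ha, hb⟩ := h2 _ hab
    obtain ⟨rfl, rfl⟩ := pair_inj.1 e
    exact ⟨ha, hb⟩
  refine ⟨g, ⟨?_, ?_, ?_, ?_⟩, hm⟩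
  · intro a ha
    obtain ⟨b, hb⟩ := h3 a ha
    exact ⟨b, (hm _ _ hb).2, hb⟩
  · intro b hb
    obtain ⟨a, ha⟩ := h6 b hb
    exact ⟨a, (hm _ _ ha).1, ha⟩
  · intro a b b' _ _ _; exact h4 a b b'
  · intro a a' b _ _ _; exact h5 a a' b
end
end NFUweak

namespace NFUweak
section
set_option linter.unusedSectionVars false
variable {M : Type} [LNFU.Structure M] [IsNFU M]

/-- equipollence depends on members only -/
theorem equip_ext {X Y : M} (h : ∀ z, smem z X ↔ smem z Y) : equipollent X Y := by
  refine equip_of (k := 0) (fun a b => a = b) (.eq v1 v0) (by simp) ⟨?_, ?_, ?_, ?_⟩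
  · intro a ha; exact ⟨a, (h a).1 ha, rfl⟩
  · intro a ha; exact ⟨a, (h a).2 ha, rfl⟩
  · rintro a b c _ _ _ rfl rfl; rfl
  · rintro a b c _ _ _ rfl rfl; rfl

theorem equip_refl (X : M) : equipollent X X := equip_ext fun _ => Iff.rfl

theorem equip_symm {X Y : M} (h : equipollent X Y) : equipollent Y X := by
  obtain ⟨g, hg, -⟩ := equip_bij h
  exact equip_of (k := 0) (fun a b => smem (spair b a) g) (.mem (.pair v0 v1) (.con g)) (by simp)
    ⟨hg.sur, hg.tot, fun a b b' ha hb hb' => hg.inj b b' a hb hb' ha,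
      fun a a' b ha ha' hb => hg.fn b a a' hb ha ha'⟩

theorem equip_trans {X Y Z : M} (h : equipollent X Y) (h' : equipollent Y Z) : equipollent X Z := by
  obtain ⟨g, hg, hm⟩ := equip_bij h
  obtain ⟨g', hg', hm'⟩ := equip_bij h'
  refine equip_of (k := 0) (fun a c => ∃ b, smem (spair a b) g ∧ smem (spair b c) g')
    (fex 0 (fand (.mem (.pair v2 v0) (.con g)) (.mem (.pair v0 v1) (.con g')))) (by simp)
    ⟨?_, ?_, ?_, ?_⟩
  · intro a ha
    obtain ⟨b, hb, h1⟩ := hg.tot a ha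
    obtain ⟨c, hc, h2⟩ := hg'.tot b hb
    exact ⟨c, hc, b, h1, h2⟩
  · intro c hc
    obtain ⟨b, hb, h1⟩ := hg'.sur c hc
    obtain ⟨a, ha, h2⟩ := hg.sur b hb
    exact ⟨a, ha, b, h2, h1⟩
  · rintro a c c' ha hc hc' ⟨b, h1, h2⟩ ⟨b', h3, h4⟩
    obtain rfl := hg.fn a b b' ha (hm _ _ h1).2 (hm _ _ h3).2 h1 h3
    exact hg'.fn _ _ _ (hm _ _ h1).2 hc hc' h2 h4
  · rintro a a' c ha ha' hc ⟨b, h1, h2⟩ ⟨b', h3, h4⟩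
    obtain rfl := hg'.inj b b' c (hm _ _ h1).2 (hm _ _ h3).2 hc h2 h4
    exact hg.inj _ _ _ ha ha' (hm _ _ h1).2 h1 h3

theorem card_eq_iff {X Y : M} : card X = card Y ↔ equipollent X Y := by
  constructor
  · intro h
    have := (mem_card (z := X) (X := X)).2 (equip_refl X)
    rwa [h, mem_card] at this
  · intro h
    refine ext' (set_card _) (set_card _) fun z => ?_
    rw [mem_card, mem_card]
    exact ⟨fun h1 => equip_trans h1 h, fun h1 => equip_trans h1 (equip_symm h)⟩

theorem equip_iota {X Y : M} : equipollent (iota X) (iota Y) ↔ equipollent X Y := by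
  constructor
  · intro h
    obtain ⟨g, hg, hm⟩ := equip_bij h
    refine equip_of (k := 0) (fun a b => smem (spair (sing a) (sing b)) g)
      (fex 1 (fex 1 (fand (fSing v1 v3) (fand (fSing v0 v2) (.mem (.pair v1 v0) (.con g))))))
      (by simp [isSing_iff]) ⟨?_, ?_, ?_, ?_⟩
    · intro a ha
      obtain ⟨b, hb, h1⟩ := hg.tot (sing a) (by simpa using ha)
      obtain ⟨b, hb2, rfl⟩ := mem_iota.1 hb
      exact ⟨b, hb2, h1⟩
    · intro a ha
      obtain ⟨b, hb, h1⟩ := hg.sur (sing a) (by simpa using ha)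
      obtain ⟨b, hb2, rfl⟩ := mem_iota.1 hb
      exact ⟨b, hb2, h1⟩
    · intro a b b' ha hb hb' h1 h2
      exact sing_inj.1 (hg.fn _ _ _ (hm _ _ h1).1 (hm _ _ h1).2 (hm _ _ h2).2 h1 h2)
    · intro a b b' ha hb hb' h1 h2
      exact sing_inj.1 (hg.inj _ _ _ (hm _ _ h1).1 (hm _ _ h2).1 (hm _ _ h2).2 h1 h2)
  · intro h
    obtain ⟨g, hg, hm⟩ := equip_bij h
    refine equip_of (k := 1) (fun s t => ∃ a b, s = sing a ∧ t = sing b ∧ smem (spair a b) g)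
      (fex 0 (fex 0 (fand (fSing v3 v1) (fand (fSing v2 v0) (.mem (.pair v1 v0) (.con g))))))
      (by simp [isSing_iff]) ⟨?_, ?_, ?_, ?_⟩
    · intro a ha
      obtain ⟨a, ha2, rfl⟩ := mem_iota.1 ha
      obtain ⟨b, hb, h1⟩ := hg.tot a ha2
      exact ⟨sing b, by simpa using hb, a, b, rfl, rfl, h1⟩
    · intro a ha
      obtain ⟨a, ha2, rfl⟩ := mem_iota.1 ha
      obtain ⟨b, hb, h1⟩ := hg.sur a ha2
      exact ⟨sing b, by simpa using hb, b, a, rfl, rfl, h1⟩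
    · rintro _ _ _ - - - ⟨a, b, rfl, rfl, h1⟩ ⟨a', b', h, rfl, h2⟩
      obtain rfl := sing_inj.1 h
      rw [hg.fn _ _ _ (hm _ _ h1).1 (hm _ _ h1).2 (hm _ _ h2).2 h1 h2]
    · rintro _ _ _ - - - ⟨a, b, rfl, rfl, h1⟩ ⟨a', b', rfl, h, h2⟩
      obtain rfl := sing_inj.1 h
      rw [hg.inj _ _ _ (hm _ _ h1).1 (hm _ _ h2).1 (hm _ _ h2).2 h1 h2]

theorem equip_pow {X Y : M} (h : equipollent X Y) : equipollent (pow X) (pow Y) := by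
  obtain ⟨g, hg, hm⟩ := equip_bij h
  refine equip_of (k := 1)
    (fun z w => (∀ b, smem b w ↔ ∃ a, smem a z ∧ smem (spair a b) g))
    (.all 0 (fiff (.mem v0 v1) (fex 0 (fand (.mem v0 v3) (.mem (.pair v0 v1) (.con g))))))
    (by simp) ⟨?_, ?_, ?_, ?_⟩
  · intro z hz
    obtain ⟨w, h1, h2⟩ := comp 0
      (fex 0 (fand (.mem v0 (.con z)) (.mem (.pair v0 v1) (.con g))) : Fm M [0])
    simp at h2
    refine ⟨w, mem_pow.2 ⟨h1, fun b hb => ?_⟩, h2⟩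
    obtain ⟨a, -, ha⟩ := (h2 b).1 hb
    exact (hm _ _ ha).2
  · intro w hw
    obtain ⟨z, h1, h2⟩ := comp 0
      (fex 0 (fand (.mem v0 (.con w)) (.mem (.pair v1 v0) (.con g))) : Fm M [0])
    simp at h2
    refine ⟨z, mem_pow.2 ⟨h1, fun b hb => ?_⟩, fun b => ?_⟩
    · obtain ⟨a, -, ha⟩ := (h2 b).1 hb
      exact (hm _ _ ha).1
    · constructor
      · intro hb
        obtain ⟨a, ha, h3⟩ := hg.sur b ((mem_pow.1 hw).2 b hb)
        exact ⟨a, (h2 a).2 ⟨b, hb, h3⟩, h3⟩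
      · rintro ⟨a, ha, h3⟩
        obtain ⟨b', hb', h4⟩ := (h2 a).1 ha
        rwa [hg.fn a b b' (hm _ _ h3).1 (hm _ _ h3).2 (hm _ _ h4).2 h3 h4]
  · intro z w w' hz hw hw' h1 h2
    exact ext' (mem_pow.1 hw).1 (mem_pow.1 hw').1 fun b => (h1 b).trans (h2 b).symm
  · have key : ∀ z z' w, smem z (pow X) → 
        (∀ b, smem b w ↔ ∃ a, smem a z ∧ smem (spair a b) g) →
        (∀ b, smem b w ↔ ∃ a, smem a z' ∧ smem (spair a b) g) → ∀ a, smem a z → smem a z' := by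
      intro z z' w hz h1 h2 a ha
      obtain ⟨b, hb, h3⟩ := hg.tot a ((mem_pow.1 hz).2 a ha)
      obtain ⟨a', ha', h4⟩ := (h2 b).1 ((h1 b).2 ⟨a, ha, h3⟩)
      rwa [hg.inj a a' b (hm _ _ h3).1 (hm _ _ h4).1 hb h3 h4]
    intro z z' w hz hz' hw h1 h2
    exact ext' (mem_pow.1 hz).1 (mem_pow.1 hz').1 fun a =>
      ⟨key z z' w hz h1 h2 a, key z' z w hz' h2 h1 a⟩

theorem iota_inj {X Y : M} (hX : sset X) (hY : sset Y) (h : iota X = iota Y) : X = Y := by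
  refine ext' hX hY fun z => ?_
  have : smem (sing z) (iota X) ↔ smem (sing z) (iota Y) := by rw [h]
  simpa using this

theorem equip_pow_iota (X : M) : equipollent (pow (iota X)) (iota (pow X)) := by
  refine equip_of (k := 2)
    (fun w s => ∃ z, s = sing z ∧ w = iota z)
    (fex 1 (fand (fSing v1 v0) (fIota v2 v0)))
    (by simp [isSing_iff, isIota_iff]) ⟨?_, ?_, ?_, ?_⟩
  · intro w hw
    obtain ⟨z, h1, h2⟩ := comp 0
      (fex 1 (fand (fSing v0 v1) (.mem v0 (.con w))) : Fm M [0])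
    simp [isSing_iff] at h2
    have hw := mem_pow.1 hw
    refine ⟨sing z, mem_iota.2 ⟨z, mem_pow.2 ⟨h1, fun x hx => ?_⟩, rfl⟩, z, rfl, ?_⟩
    · simpa using hw.2 _ ((h2 x).1 hx)
    · refine ext' hw.1 (set_iota _) fun t => ?_
      rw [mem_iota]
      constructor
      · intro ht
        obtain ⟨x, hx, rfl⟩ := mem_iota.1 (hw.2 t ht)
        exact ⟨x, (h2 x).2 ht, rfl⟩
      · rintro ⟨x, hx, rfl⟩
        exact (h2 x).1 hx
  · intro s hs
    obtain ⟨z, hz, rfl⟩ := mem_iota.1 hs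
    refine ⟨iota z, mem_pow.2 ⟨set_iota _, fun t ht => ?_⟩, z, rfl, rfl⟩
    obtain ⟨x, hx, rfl⟩ := mem_iota.1 ht
    exact mem_iota.2 ⟨x, (mem_pow.1 hz).2 x hx, rfl⟩
  · rintro _ s s' - hs hs' ⟨z, rfl, rfl⟩ ⟨z', rfl, h⟩
    simp at hs hs'
    rw [iota_inj hs.1 hs'.1 h]
  · rintro _ _ s - - - ⟨z, rfl, rfl⟩ ⟨z', h, rfl⟩
    rw [sing_inj.1 h]

theorem isT_card {t X : M} : isTOf t (card X) ↔ t = card (iota X) := by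
  constructor
  · rintro ⟨X', Y, h1, h2, h3⟩
    rw [isIota_iff] at h2; subst h2
    rw [isCard_iff] at h3; subst h3
    rw [card_eq_iff, equip_iota]; exact mem_card.1 h1
  · rintro rfl
    exact ⟨X, iota X, mem_card.2 (equip_refl X), isIota_iff.2 rfl, isCard_iff.2 rfl⟩

theorem succ_unique {s s' x : M} (h : isSuccOf s x) (h' : isSuccOf s' x) : s = s' :=
  ext' h.1 h'.1 fun z => (h.2 z).trans (h'.2 z).symm

theorem zero_unique {s s' : M} (h : isZeroCard s) (h' : isZeroCard s') : s = s' :=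
  ext' h.1 h'.1 fun z => (h.2 z).trans (h'.2 z).symm

theorem zero_card {X : M} (h : ∀ z, ¬ smem z X) : isZeroCard (card X) := by
  refine ⟨set_card X, fun y => ?_⟩
  rw [mem_card]
  constructor
  · intro h1 w hw
    obtain ⟨g, hg, -⟩ := equip_bij h1
    obtain ⟨b, hb, -⟩ := hg.tot w hw
    exact h b hb
  · intro h1
    exact equip_ext fun z => ⟨fun h2 => (h1 z h2).elim, fun h2 => (h z h2).elim⟩

theorem succ_card {X d z : M} (hz : smem z X) (hd : ∀ w, smem w d ↔ (smem w X ∧ w ≠ z)) :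
    isSuccOf (card X) (card d) := by
  refine ⟨set_card X, fun y => ?_⟩
  rw [mem_card]
  constructor
  · intro h
    obtain ⟨g, hg, hm⟩ := equip_bij h
    obtain ⟨w, hw, hwz⟩ := hg.sur z hz
    obtain ⟨e, he, he2⟩ := ex_del y w
    refine ⟨w, hw, e, he, he2, mem_card.2 ?_⟩
    refine equip_of (k := 0) (fun a b => smem (spair a b) g) (.mem (.pair v1 v0) (.con g)) (by simp)
      ⟨?_, ?_, ?_, ?_⟩
    · intro a ha
      obtain ⟨ha1, ha2⟩ := (he2 a).1 ha
      obtain ⟨b, hb, h1⟩ := hg.tot a ha1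
      refine ⟨b, (hd b).2 ⟨hb, ?_⟩, h1⟩
      rintro rfl
      exact ha2 (hg.inj _ _ _ ha1 hw hb h1 hwz)
    · intro b hb
      obtain ⟨hb1, hb2⟩ := (hd b).1 hb
      obtain ⟨a, ha, h1⟩ := hg.sur b hb1
      refine ⟨a, (he2 a).2 ⟨ha, ?_⟩, h1⟩
      rintro rfl
      exact hb2 (hg.fn _ _ _ hw hb1 hz h1 hwz)
    · intro a b b' _ _ _ h1 h2
      exact hg.fn _ _ _ (hm _ _ h1).1 (hm _ _ h1).2 (hm _ _ h2).2 h1 h2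
    · intro a b b' _ _ _ h1 h2
      exact hg.inj _ _ _ (hm _ _ h1).1 (hm _ _ h2).1 (hm _ _ h2).2 h1 h2
  · rintro ⟨w, hw, e, he, he2, hed⟩
    obtain ⟨g, hg, hm⟩ := equip_bij (mem_card.1 hed)
    refine equip_of (k := 0) (fun a b => smem (spair a b) g ∨ (a = w ∧ b = z))
      (for' (.mem (.pair v1 v0) (.con g)) (fand (.eq v1 (.con w)) (.eq v0 (.con z)))) (by simp)
      ⟨?_, ?_, ?_, ?_⟩
    · intro a ha
      by_cases haw : a = w
      · exact ⟨z, hz, Or.inr ⟨haw, rfl⟩⟩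
      · obtain ⟨b, hb, h1⟩ := hg.tot a ((he2 a).2 ⟨ha, haw⟩)
        exact ⟨b, ((hd b).1 hb).1, Or.inl h1⟩
    · intro b hb
      by_cases hbz : b = z
      · exact ⟨w, hw, Or.inr ⟨rfl, hbz⟩⟩
      · obtain ⟨a, ha, h1⟩ := hg.sur b ((hd b).2 ⟨hb, hbz⟩)
        exact ⟨a, ((he2 a).1 ha).1, Or.inl h1⟩
    · rintro a b b' _ _ _ (h1 | ⟨rfl, rfl⟩) (h2 | ⟨h3, h4⟩)
      · exact hg.fn _ _ _ (hm _ _ h1).1 (hm _ _ h1).2 (hm _ _ h2).2 h1 h2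
      · exact (((he2 a).1 (hm _ _ h1).1).2 h3).elim
      · exact (((he2 a).1 (hm _ _ h2).1).2 rfl).elim
      · exact h4.symm
    · rintro a a' b _ _ _ (h1 | ⟨rfl, rfl⟩) (h2 | ⟨h3, h4⟩)
      · exact hg.inj _ _ _ (hm _ _ h1).1 (hm _ _ h2).1 (hm _ _ h2).2 h1 h2
      · exact (((hd b).1 (hm _ _ h1).2).2 h4).elim
      · exact (((hd b).1 (hm _ _ h2).2).2 rfl).elim
      · exact h3.symm

/-! ### Natural numbers -/

theorem nat_zero {z : M} (hz : isZeroCard z) : isNat z := fun _ hI => hI.2.1 z hz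

theorem nat_succ {n m : M} (hn : isNat n) (h : isSuccOf m n) : isNat m :=
  fun I hI => hI.2.2 n m (hn I hI) h

theorem nat_ind (k : ℕ) (φ : Fm M [k + 2])
    (h0 : ∀ z, isZeroCard z → φ.real (z ;; Env.nil))
    (hs : ∀ a b, isNat a → isNat b → φ.real (a ;; Env.nil) → isSuccOf b a → φ.real (b ;; Env.nil))
    (n : M) (hn : isNat n) : φ.real (n ;; Env.nil) := by
  obtain ⟨I, h1, h2⟩ := comp (k + 2) (fand (fNat v0) φ)
  simp at h2
  refine ((h2 n).1 (hn I ⟨h1, ?_, ?_⟩)).2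
  · intro z hz; exact (h2 z).2 ⟨nat_zero hz, h0 z hz⟩
  · intro a b ha hb
    obtain ⟨h3, h4⟩ := (h2 a).1 ha
    exact (h2 b).2 ⟨nat_succ h3 hb, hs a b h3 (nat_succ h3 hb) h4 hb⟩

/-- Every natural number is the cardinal of some set omitting some object. -/
theorem nat_card {n : M} (hn : isNat n) : ∃ X z, n = card X ∧ ¬ smem z X := by
  obtain ⟨e, -, he⟩ := ex_empty (M := M)
  obtain ⟨u, hu⟩ := ex_univ (M := M)
  have hue : u ≠ e := fun h => he u (h ▸ hu u)
  let a : M := spair e u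
  have hae : ∀ w, a ≠ spair w e := fun w h => hue (pair_inj.1 h).2
  let Q : M → Prop := fun n => ∃ X z, isCardOf n X ∧ ¬ smem z X ∧
    (∀ x, smem x X → (x = a ∨ ∃ w, smem w X ∧ x = spair w e)) ∧
    (z = a ∨ ∃ w, smem w X ∧ z = spair w e)
  let φ : Fm M [2] := fex 1 (fex 0 (fand (fCard v2 v1) (fand (fnot (.mem v0 v1)) (fand
    (.all 0 (.imp (.mem v0 v2) (for' (.eq v0 (.con a))
      (fex 0 (fand (.mem v0 v3) (.eq v1 (.pair v0 (.con e)))))))) 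
    (for' (.eq v0 (.con a)) (fex 0 (fand (.mem v0 v2) (.eq v1 (.pair v0 (.con e))))))))))
  have hφ : ∀ n, φ.real (n ;; Env.nil) ↔ Q n := by
    intro n; simp [φ, Q]
  have hQ : Q n := by
    rw [← hφ]
    refine nat_ind 0 φ ?_ ?_ n hn
    · intro z hz
      rw [hφ]
      refine ⟨e, a, ?_, he a, fun x hx => (he x hx).elim, Or.inl rfl⟩
      rw [isCard_iff]; exact zero_unique hz (zero_card he)
    · intro n m _ _ h hs
      rw [hφ] at h ⊢
      obtain ⟨X, z, h1, h2, h3, h4⟩ := h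
      rw [isCard_iff] at h1; subst h1
      obtain ⟨X', hX', hm⟩ := ex_ins X z
      have hz' : smem z X' := (hm z).2 (Or.inr rfl)
      refine ⟨X', spair z e, ?_, ?_, ?_, Or.inr ⟨z, hz', rfl⟩⟩
      · rw [isCard_iff]
        refine succ_unique hs (succ_card hz' fun w => ?_)
        rw [hm]
        constructor
        · intro hw
          refine ⟨Or.inl hw, ?_⟩
          rintro rfl; exact h2 hw
        · rintro ⟨h5 | h5, h6⟩
          · exact h5
          · exact (h6 h5).elim
      · rw [hm]
        rintro (h5 | h5)
        · rcases h3 _ h5 with h6 | ⟨w, hw, h6⟩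
          · exact hae _ h6.symm
          · rw [(pair_inj.1 h6).1] at h2; exact h2 hw
        · rcases h4 with h6 | ⟨w, hw, h6⟩
          · exact hae z (by rw [h5, h6])
          · rw [h6, pair_inj] at h5
            rw [← h6] at h5
            exact h2 (h5.1 ▸ hw)
      · intro x hx
        rcases (hm x).1 hx with h5 | rfl
        · exact (h3 x h5).imp_right fun ⟨w, hw, h6⟩ => ⟨w, (hm w).2 (Or.inl hw), h6⟩
        · exact h4.imp_right fun ⟨w, hw, h6⟩ => ⟨w, (hm w).2 (Or.inl hw), h6⟩
  obtain ⟨X, z, h1, h2, -⟩ := hQ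
  exact ⟨X, z, isCard_iff.1 h1, h2⟩

theorem iota_del {X d z : M} (hd : ∀ w, smem w d ↔ (smem w X ∧ w ≠ z)) (w : M) :
    smem w (iota d) ↔ (smem w (iota X) ∧ w ≠ sing z) := by
  rw [mem_iota, mem_iota]
  constructor
  · rintro ⟨x, hx, rfl⟩
    rw [hd] at hx
    exact ⟨⟨x, hx.1, rfl⟩, fun h => hx.2 (sing_inj.1 h)⟩
  · rintro ⟨⟨x, hx, rfl⟩, h⟩
    exact ⟨x, (hd x).2 ⟨hx, fun h' => h (h' ▸ rfl)⟩, rfl⟩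

/-- If `m = S(n)`, then `T(m) = S(T(n))`. -/
theorem T_succ {n m m' : M} (hn : isNat n) (h : isSuccOf m n) (hT : isTOf m' m) :
    ∃ n', isTOf n' n ∧ isSuccOf m' n' := by
  obtain ⟨X, Y, h1, h2, h3⟩ := hT
  rw [isIota_iff] at h2; subst h2
  rw [isCard_iff] at h3; subst h3
  obtain ⟨z, hz, d, hd, hd2, hdn⟩ := (h.2 X).1 h1
  refine ⟨card (iota d), ⟨d, iota d, hdn, isIota_iff.2 rfl, isCard_iff.2 rfl⟩, ?_⟩
  exact succ_card (z := sing z) (by simpa using hz) (iota_del hd2)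

theorem T_ex {n : M} (hn : isNat n) : ∃ t, isTOf t n := by
  obtain ⟨X, -, rfl, -⟩ := nat_card hn
  exact ⟨_, isT_card.2 rfl⟩

theorem T_unique {n t t' : M} (hn : isNat n) (h : isTOf t n) (h' : isTOf t' n) : t = t' := by
  obtain ⟨X, -, rfl, -⟩ := nat_card hn
  rw [isT_card] at h h'
  rw [h, h']

theorem T_inj {n m t : M} (hn : isNat n) (hm : isNat m) (h : isTOf t n) (h' : isTOf t m) :
    n = m := by
  obtain ⟨X, -, rfl, -⟩ := nat_card hn
  obtain ⟨Y, -, rfl, -⟩ := nat_card hm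
  rw [isT_card] at h h'
  rw [h, card_eq_iff, equip_iota] at h'
  exact card_eq_iff.2 h'

theorem T_zero {z t : M} (hz : isZeroCard z) (h : isTOf t z) : isZeroCard t := by
  obtain ⟨X, Y, h1, h2, h3⟩ := h
  rw [isIota_iff] at h2; subst h2
  rw [isCard_iff] at h3; subst h3
  refine zero_card fun w hw => ?_
  obtain ⟨x, hx, -⟩ := mem_iota.1 hw
  exact (hz.2 X).1 h1 x hx

theorem T_nat {n t : M} (hn : isNat n) (h : isTOf t n) : isNat t := by
  have := nat_ind 0 (.all 3 (.imp (fT v0 v1) (fNat v0)) : Fm M [2]) ?_ ?_ n hn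
  · simp at this; exact this t h
  · intro z hz; simp; intro t ht
    exact nat_zero (T_zero hz ht)
  · intro a b ha hb; simp; intro ih hs t ht
    obtain ⟨n', h1, h2⟩ := T_succ ha hs ht
    exact nat_succ (ih _ h1) h2

theorem succ_ex {n : M} (hn : isNat n) : ∃ m, isSuccOf m n := by
  obtain ⟨X, z, rfl, hz⟩ := nat_card hn
  obtain ⟨X', hX', hm⟩ := ex_ins X z
  refine ⟨card X', succ_card ((hm z).2 (Or.inr rfl)) fun w => ?_⟩
  rw [hm]
  constructor
  · intro hw
    exact ⟨Or.inl hw, by rintro rfl; exact hz hw⟩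
  · rintro ⟨h5 | h5, h6⟩
    · exact h5
    · exact (h6 h5).elim

theorem T_surj {m : M} (hm : isNat m) : ∃ n, isNat n ∧ isTOf m n := by
  have := nat_ind 1 (fex 2 (fand (fNat v0) (fT v1 v0)) : Fm M [3]) ?_ ?_ m hm
  · simpa using this
  · intro z hz; simp
    obtain ⟨t, ht⟩ := T_ex (nat_zero hz)
    obtain rfl := zero_unique hz (T_zero hz ht)
    exact ⟨z, nat_zero hz, ht⟩
  · intro a b ha hb; simp; intro n hn hT hs
    obtain ⟨m, hm⟩ := succ_ex hn
    have hmn := nat_succ hn hm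
    obtain ⟨t, ht⟩ := T_ex hmn
    obtain ⟨n', h1, h2⟩ := T_succ hn hm ht
    obtain rfl := T_unique hn hT h1
    obtain rfl := succ_unique hs h2
    exact ⟨m, hmn, ht⟩

theorem equip_nat {N : M} (hN : isNatSet N) : equipollent N (iota N) := by
  refine equip_of (k := 3) (fun n s => ∃ m, s = sing m ∧ isTOf n m)
    (fex 2 (fand (fSing v1 v0) (fT v2 v0))) (by simp [isSing_iff]) ⟨?_, ?_, ?_, ?_⟩
  · intro n hn
    obtain ⟨m, hm, hT⟩ := T_surj ((hN.2 n).1 hn)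
    exact ⟨sing m, by simpa using (hN.2 m).2 hm, m, rfl, hT⟩
  · intro s hs
    obtain ⟨m, hm, rfl⟩ := mem_iota.1 hs
    have hm := (hN.2 m).1 hm
    obtain ⟨t, ht⟩ := T_ex hm
    exact ⟨t, (hN.2 _).2 (T_nat hm ht), m, rfl, ht⟩
  · rintro n _ _ hn hs hs' ⟨m, rfl, hm⟩ ⟨m', rfl, hm'⟩
    simp [hN.2] at hs hs'
    rw [T_inj hs hs' hm hm']
  · rintro n n' _ hn hn' hs ⟨m, rfl, hm⟩ ⟨m', h, hm'⟩
    obtain rfl := sing_inj.1 h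
    simp [hN.2] at hs
    exact T_unique hs hm hm'

theorem card_not_empty (X : M) : ¬ isEmptySet (card X) :=
  fun h => h.2 X (mem_card.2 (equip_refl X))

end

theorem stmt12 :
    ∀ (M : Type) [LNFU.Structure M] [Nonempty M], M ⊨ NFUmAC →
      ∀ f : M, isBethFun f → ∀ n y, isNat n → smem (spair n y) f → ¬ isEmptySet y →
        ∀ n' y' z, isTOf n' n → smem (spair n' y') f → isTOf z y → y' = z := by
  intro M _ _ hM f hf n y hn
  haveI : IsNFU M := ⟨hM⟩
  obtain ⟨-, -, htot, -, hzero, hsucc⟩ := hf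
  have key := nat_ind 0 (.all 2 (.imp (.mem (.pair v1 v0) (.con f)) (.imp (fnot (fEmpty v0))
    (.all 3 (.all 3 (.all 3 (.imp (fT v2 v4) (.imp (.mem (.pair v2 v1) (.con f))
      (.imp (fT v0 v3) (.eq v1 v0))))))))) : Fm M [2]) ?_ ?_ n hn
  · simp at key; exact key y
  · intro z hz; simp
    intro y hy _ z' y' t hz' hy' ht
    obtain ⟨N, hN, hyN⟩ := hzero z y hz hy
    obtain ⟨N', hN', hyN'⟩ := hzero z' y' (T_zero hz hz') hy'
    obtain rfl : N = N' := ext' hN.1 hN'.1 fun x => (hN.2 x).trans (hN'.2 x).symm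
    rw [isCard_iff] at hyN hyN'
    subst hyN hyN'
    rw [isT_card] at ht
    rw [ht, card_eq_iff]
    exact equip_nat hN
  · intro a b ha hb; simp
    intro ih hs y hy hye b' y' t hb' hy' ht
    obtain ⟨a', ha', hs'⟩ := T_succ ha hs hb'
    obtain ⟨y0, hy0⟩ := htot a ha
    have han := T_nat ha ha'
    obtain ⟨y1, hy1⟩ := htot a' han
    rcases hsucc a b y0 y ha hs hy0 hy with h | ⟨hne, h | h⟩
    · exact (hye h.2).elim
    · obtain ⟨X, Y, P, h1, h2, h3, h4⟩ := h
      rw [isIota_iff] at h1; subst h1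
      rw [isCard_iff] at h2; subst h2
      rw [isPow_iff] at h3; subst h3
      rw [isCard_iff] at h4; subst h4
      have e1 := ih _ hy0 hne a' y1 (card (iota (iota X))) ha' hy1 (isT_card.2 rfl)
      subst e1
      rw [isT_card] at ht
      subst ht
      rcases hsucc a' b' _ y' han hs' hy1 hy' with h | ⟨-, h | h⟩
      · exact (card_not_empty _ h.1).elim
      · obtain ⟨X', Y, P, h1, h2, h3, h4⟩ := h
        rw [isIota_iff] at h1; subst h1
        rw [isCard_iff, card_eq_iff, equip_iota] at h2
        rw [isPow_iff] at h3; subst h3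
        rw [isCard_iff] at h4; subst h4
        rw [card_eq_iff]
        exact equip_trans (equip_pow (equip_symm h2)) (equip_pow_iota X)
      · exact (h.2 ⟨iota X, _, isIota_iff.2 rfl, isCard_iff.2 rfl⟩).elim
    · exact (hye h.1).elim

end NFUweak
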